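/- arXiv:2403.06007 — 5 statements merged into one kernel-verified Lean document; each statement's English description precedes it below -/
import Mathlib

section
/- Consider a finite directed graph G = (V, E) with no self-loops; for node v_j, its in-neighborhood is N_j^- = {v_i : (v_j, v_i) ∈ E} and its out-neighborhood is N_j^+ = {v_l : (v_l, v_j) ∈ E}. For each time step k ≥ 0 and each node v_j, let N_j^+[k] ⊆ N_j^+ be the set of out-neighbors to which v_j sends at step k, and let N_j^-[k] = {v_i ∈ N_j^- : v_j ∈ N_i^+[k]}. Let real weights w_{lj}[k] be given for all v_l ∈ N_j^+[k] ∪ {v_j} such that w_{jj}[k] + Σ_{v_l ∈ N_j^+[k]} w_{lj}[k] = 1 for every j and k. Let the states x_j[k] ∈ ℝ² evolve by x_j[k+1] = w_{jj}[k] x_j[k] + Σ_{v_i ∈ N_j^-[k]} w_{ji}[k] x_i[k], from arbitrary initial values x_j[0]. For each ordered pair with v_l ∈ N_j^+, define σ_{lj}[0] = 0 and σ_{lj}[k+1] = σ_{lj}[k] + w_{lj}[k] x_j[k] if v_l ∈ N_j^+[k], and σ_{lj}[k+1] = σ_{lj}[k] otherwise. Then for every node v_j and every k ≥ 0, the quantity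 η_j[k] := x_j[k] + Σ_{v_l ∈ N_j^+} σ_{lj}[k] − Σ_{v_i ∈ N_j^-} σ_{ji}[k] is invariant: η_j[k] = x_j[0]. -/
open Finset

/-- **Local invariant of general linear-iterative averaging algorithms.**
On a finite directed graph `E` with no self-loops (where `(v_j, v_i) ∈ E`,
i.e. `E j i`, means `v_j` receives from `v_i`), with time-varying send sets
`Nplus k j ⊆ N_j^+`, weights summing to one at each node and step, states
`x` updated linearly with these weights, and running sums `σ k l j` of the
values sent by `v_j` to `v_l`, the local quantity
`η_j[k] = x_j[k] + Σ_{l ∈ N_j^+} σ_{lj}[k] − Σ_{i ∈ N_j^-} σ_{ji}[k]`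
equals `x_j[0]` for all `k`. -/
theorem local_invariant_general
    {V : Type*} [Fintype V] [DecidableEq V]
    (E : V → V → Prop) [DecidableRel E]
    (hirr : ∀ v, ¬ E v v)
    (Nplus : ℕ → V → Finset V)
    (hNplus : ∀ k j, Nplus k j ⊆ univ.filter (fun l => E l j))
    (w : ℕ → V → V → ℝ)
    (hw : ∀ k j, w k j j + ∑ l ∈ Nplus k j, w k l j = 1)
    (x : ℕ → V → Fin 2 → ℝ)
    (hx : ∀ k j, x (k + 1) j =
      w k j j • x k j +
        ∑ i ∈ univ.filter (fun i => E j i ∧ j ∈ Nplus k i), w k j i • x k i)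
    (σ : ℕ → V → V → Fin 2 → ℝ)
    (hσ0 : ∀ l j, σ 0 l j = 0)
    (hσ : ∀ k l j, σ (k + 1) l j =
      if l ∈ Nplus k j then σ k l j + w k l j • x k j else σ k l j) :
    ∀ j k,
      x k j + (∑ l ∈ univ.filter (fun l => E l j), σ k l j)
        - (∑ i ∈ univ.filter (fun i => E j i), σ k j i) = x 0 j := by
  intro j k
  induction k with
  | zero => simp [hσ0]
  | succ k ih =>
    have hσ_add : ∀ l i, σ (k + 1) l i =
        σ k l i + if l ∈ Nplus k i then w k l i • x k i else 0 := by
      intro l i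
      rw [hσ]
      split_ifs <;> simp
    have hsent : ∑ l ∈ univ.filter (fun l => E l j),
        (if l ∈ Nplus k j then w k l j • x k j else 0) =
          (∑ l ∈ Nplus k j, w k l j) • x k j := by
      rw [← sum_filter, filter_mem_eq_inter, inter_eq_right.mpr (hNplus k j), sum_smul]
    have hkept : x k j = w k j j • x k j + (∑ l ∈ Nplus k j, w k l j) • x k j := by
      rw [← add_smul, hw, one_smul]
    simp only [hσ_add, sum_add_distrib, hsent]
    rw [← sum_filter, filter_filter, hx, ← ih]
    nth_rewrite 3 [hkept]
    abel
end

section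
/- Consider a finite directed graph G = (V, E) with no self-loops; for node v_j, its in-neighborhood is N_j^- = {v_i : (v_j, v_i) ∈ E}, its out-neighborhood is N_j^+ = {v_l : (v_l, v_j) ∈ E}, and its out-degree is D_j^+ = |N_j^+|. Let the states x_j[k] ∈ ℝ² evolve by the ratio-consensus iteration x_j[k+1] = (1/(1+D_j^+)) x_j[k] + Σ_{v_i ∈ N_j^-} (1/(1+D_i^+)) x_i[k], from arbitrary initial values x_j[0]. Define running sums σ_j[0] = 0 and σ_j[k+1] = σ_j[k] + (1/(1+D_j^+)) x_j[k]. Then for every node v_j and every k ≥ 0, the quantity η_j[k] := x_j[k] + D_j^+ σ_j[k] − Σ_{v_i ∈ N_j^-} σ_i[k] is invariant: η_j[k] = x_j[0]. -/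
open Finset

/-- **Local invariant of the ratio-consensus algorithm.**
On a finite directed graph `E` with no self-loops (where `E j i` means
`v_j` receives from `v_i`), with out-degrees `D`, states evolving by the
ratio-consensus iteration, and running sums `σ`, the local quantity
`η_j[k] = x_j[k] + D_j^+ σ_j[k] − Σ_{i ∈ N_j^-} σ_i[k]` equals `x_j[0]`
for all `k`. -/
theorem local_invariant_ratio_consensus
    {V : Type*} [Fintype V] [DecidableEq V]
    (E : V → V → Prop) [DecidableRel E]
    (hirr : ∀ v, ¬ E v v)
    (D : V → ℕ)
    (hD : ∀ j, D j = (univ.filter (fun l => E l j)).card)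
    (x σ : ℕ → V → Fin 2 → ℝ)
    (hx : ∀ k j, x (k + 1) j =
      (1 / (1 + (D j : ℝ))) • x k j +
        ∑ i ∈ univ.filter (fun i => E j i), (1 / (1 + (D i : ℝ))) • x k i)
    (hσ0 : ∀ j, σ 0 j = 0)
    (hσ : ∀ k j, σ (k + 1) j = σ k j + (1 / (1 + (D j : ℝ))) • x k j) :
    ∀ j k,
      x k j + (D j : ℝ) • σ k j - ∑ i ∈ univ.filter (fun i => E j i), σ k i
        = x 0 j := by
  intro j k
  induction k with
  | zero => simp [hσ0]
  | succ k ih =>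
    rw [← ih, hx, hσ]
    simp only [hσ, sum_add_distrib]
    have hpos : (1 + (D j : ℝ)) ≠ 0 := by positivity
    have hsplit : x k j = (1 / (1 + (D j : ℝ))) • x k j
        + (D j : ℝ) • (1 / (1 + (D j : ℝ))) • x k j := by
      rw [smul_smul, ← add_smul, ← one_add_mul, mul_one_div_cancel hpos, one_smul]
    rw [smul_add]
    linear_combination -hsplit
end

section
/- Consider a finite directed graph G = (V, E) with no self-loops; for node v_i, its in-neighborhood is N_i^- = {v_{i'} : (v_i, v_{i'}) ∈ E}, its out-neighborhood is N_i^+, and its out-degree is D_i^+ = |N_i^+|. Suppose at some time step k₀ every node v_i ∈ V satisfies the any-time consistency check x_i[k₀] + D_i^+ σ_i[k₀] − Σ_{v_{i'} ∈ N_i^-} σ_{i'}[k₀] = x_i[0], where x_i[k₀], x_i[0] ∈ ℝ² and σ_i[k₀] ∈ ℝ² are arbitrary given vectors. Then the total state is preserved: Σ_{v_i ∈ V} x_i[k₀] = Σ_{v_i ∈ V} x_i[0]. (Consequently, an error-free average-consensus iteration restarted from the values x_i[k₀] converges to the same average as one started from the values x_i[0].) -/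
open Finset

/-- **Validity of all any-time consistency checks implies total-state preservation.**
On a finite directed graph `E` with no self-loops (where `E i i'` means
`v_i` receives from `v_{i'}`), if every node `v_i` satisfies the any-time
consistency check
`x_i[k₀] + D_i^+ σ_i[k₀] − Σ_{i' ∈ N_i^-} σ_{i'}[k₀] = x_i[0]`,
then `Σ_i x_i[k₀] = Σ_i x_i[0]`. -/
theorem atc_implies_sum_preserved
    {V : Type*} [Fintype V] [DecidableEq V]
    (E : V → V → Prop) [DecidableRel E]
    (hirr : ∀ v, ¬ E v v)
    (x0 xk0 σ : V → Fin 2 → ℝ)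
    (hATC : ∀ i,
      xk0 i + (((univ.filter (fun l => E l i)).card : ℝ)) • σ i
        - ∑ i' ∈ univ.filter (fun i' => E i i'), σ i' = x0 i) :
    ∑ i, xk0 i = ∑ i, x0 i := by
  have double_count : ∑ i, ∑ i' ∈ univ.filter (fun i' => E i i'), σ i'
      = ∑ i, (((univ.filter (fun l => E l i)).card : ℝ)) • σ i := by
    simp_rw [sum_filter]
    rw [sum_comm]
    refine sum_congr rfl fun i _ => ?_
    rw [← sum_filter, sum_const, Nat.cast_smul_eq_nsmul]
  rw [← sum_congr rfl fun i _ => hATC i, sum_sub_distrib, sum_add_distrib, double_count,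
    add_sub_cancel_right]
end

section
/- Consider a finite directed graph G = (V, E) with no self-loops; for node v_j, its in-neighborhood is N_j^- = {v_i : (v_j, v_i) ∈ E}, its out-neighborhood is N_j^+, and its out-degree is D_j^+ = |N_j^+|. Fix a node v_f, a time step k* ≥ 0, and an error vector e ∈ ℝ². Let the faulty trajectory be defined by: x_j[k+1] = (1/(1+D_j^+)) x_j[k] + Σ_{v_i ∈ N_j^-} (1/(1+D_i^+)) x_i[k] + δ_{j,f} δ_{k,k*} e (i.e., the additive error e corrupts node v_f's state exactly at step k*, and all nodes otherwise execute the ratio-consensus update correctly), with running sums σ_j[0] = 0 and σ_j[k+1] = σ_j[k] + (1/(1+D_j^+)) x_j[k] computed from the corrupted states. Then for every node v_j ≠ v_f and every k ≥ 0, the invariant of v_j still holds: x_j[k] + D_j^+ σ_j[k] − Σ_{v_i ∈ N_j^-} σ_i[k] = x_j[0]. -/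
open Finset

/-- **An additive error at a faulty node does not violate other nodes' invariants.**
On a finite directed graph `E` with no self-loops (where `E j i` means
`v_j` receives from `v_i`), suppose an additive error `e ∈ ℝ²` corrupts node
`v_f`'s state exactly at step `k*`, while all nodes otherwise execute the
ratio-consensus update correctly, and the running sums are computed from the
corrupted states. Then for every node `v_j ≠ v_f` and every `k`, the invariant
`x_j[k] + D_j^+ σ_j[k] − Σ_{i ∈ N_j^-} σ_i[k] = x_j[0]` still holds. -/
theorem error_preserves_other_invariants
    {V : Type*} [Fintype V] [DecidableEq V]
    (E : V → V → Prop) [DecidableRel E]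
    (hirr : ∀ v, ¬ E v v)
    (D : V → ℕ)
    (hD : ∀ j, D j = (univ.filter (fun l => E l j)).card)
    (f : V) (kstar : ℕ) (e : Fin 2 → ℝ)
    (x σ : ℕ → V → Fin 2 → ℝ)
    (hx : ∀ k j, x (k + 1) j =
      (1 / (1 + (D j : ℝ))) • x k j +
        (∑ i ∈ univ.filter (fun i => E j i), (1 / (1 + (D i : ℝ))) • x k i) +
        (if j = f ∧ k = kstar then e else 0))
    (hσ0 : ∀ j, σ 0 j = 0)
    (hσ : ∀ k j, σ (k + 1) j = σ k j + (1 / (1 + (D j : ℝ))) • x k j) :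
    ∀ j, j ≠ f → ∀ k,
      x k j + (D j : ℝ) • σ k j - ∑ i ∈ univ.filter (fun i => E j i), σ k i
        = x 0 j := by
  intro j hj k
  induction k with
  | zero => simp [hσ0]
  | succ k ih =>
    have hpos : (1 + (D j : ℝ)) ≠ 0 := by positivity
    have hc : (1 / (1 + (D j : ℝ))) • x k j + (D j : ℝ) • (1 / (1 + (D j : ℝ))) • x k j
        = x k j := by
      rw [smul_smul, ← add_smul, ← one_add_mul, mul_one_div_cancel hpos, one_smul]
    simp only [hx k j, hσ k, hj, false_and, if_false, add_zero, sum_add_distrib, smul_add]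
    rw [← ih]
    nth_rewrite 3 [← hc]
    abel
end

section
/- Consider a finite directed graph G = (V, E) with no self-loops; for node v_j, its in-neighborhood is N_j^- = {v_i : (v_j, v_i) ∈ E}, its out-neighborhood is N_j^+, and its out-degree is D_j^+ = |N_j^+|. Fix a node v_f, a time step k* ≥ 0, and an error vector e ∈ ℝ². Let the faulty trajectory be defined by: x_j[k+1] = (1/(1+D_j^+)) x_j[k] + Σ_{v_i ∈ N_j^-} (1/(1+D_i^+)) x_i[k] + δ_{j,f} δ_{k,k*} e, with running sums σ_j[0] = 0 and σ_j[k+1] = σ_j[k] + (1/(1+D_j^+)) x_j[k] computed from the corrupted states. Then the invariant of the faulty node v_f is violated by exactly the error: for all k > k*, x_f[k] + D_f^+ σ_f[k] − Σ_{v_i ∈ N_f^-} σ_i[k] = x_f[0] + e; in particular, if e ≠ 0 the any-time consistency check for v_f fails at every step after k*. -/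
open Finset

/-- **An additive error violates the faulty node's invariant by exactly the error.**
On a finite directed graph `E` with no self-loops (where `E j i` means
`v_j` receives from `v_i`), suppose an additive error `e ∈ ℝ²` corrupts node
`v_f`'s state exactly at step `k*`, while all nodes otherwise execute the
ratio-consensus update correctly, and the running sums are computed from the
corrupted states. Then for all `k > k*`,
`x_f[k] + D_f^+ σ_f[k] − Σ_{i ∈ N_f^-} σ_i[k] = x_f[0] + e`; in particular, if
`e ≠ 0` the any-time consistency check for `v_f` fails at every step after `k*`. -/
theorem error_shifts_faulty_invariant
    {V : Type*} [Fintype V] [DecidableEq V]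
    (E : V → V → Prop) [DecidableRel E]
    (hirr : ∀ v, ¬ E v v)
    (D : V → ℕ)
    (hD : ∀ j, D j = (univ.filter (fun l => E l j)).card)
    (f : V) (kstar : ℕ) (e : Fin 2 → ℝ)
    (x σ : ℕ → V → Fin 2 → ℝ)
    (hx : ∀ k j, x (k + 1) j =
      (1 / (1 + (D j : ℝ))) • x k j +
        (∑ i ∈ univ.filter (fun i => E j i), (1 / (1 + (D i : ℝ))) • x k i) +
        (if j = f ∧ k = kstar then e else 0))
    (hσ0 : ∀ j, σ 0 j = 0)
    (hσ : ∀ k j, σ (k + 1) j = σ k j + (1 / (1 + (D j : ℝ))) • x k j) :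
    ∀ k, kstar < k →
      (x k f + (D f : ℝ) • σ k f - ∑ i ∈ univ.filter (fun i => E f i), σ k i
          = x 0 f + e) ∧
      (e ≠ 0 →
        x k f + (D f : ℝ) • σ k f - ∑ i ∈ univ.filter (fun i => E f i), σ k i
          ≠ x 0 f) := by
  have invariant : ∀ k,
      x k f + (D f : ℝ) • σ k f - ∑ i ∈ univ.filter (fun i => E f i), σ k i
        = x 0 f + if kstar < k then e else 0 := by
    intro k
    induction k with
    | zero => simp [hσ0]
    | succ k ih =>
      have weight_split : (1 / (1 + (D f : ℝ))) • x k f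
          + (D f : ℝ) • (1 / (1 + (D f : ℝ))) • x k f = x k f := by
        have hpos : (1 + (D f : ℝ)) ≠ 0 := by positivity
        rw [smul_smul, ← add_smul, show 1 / (1 + (D f : ℝ)) + D f * (1 / (1 + (D f : ℝ))) = 1 by
          field_simp, one_smul]
      have error_step : (if kstar < k + 1 then e else 0)
          = (if kstar < k then e else 0) + (if f = f ∧ k = kstar then e else 0) := by
        rcases lt_trichotomy kstar k with h | h | h
        · simp [h, h.ne', Nat.lt_succ_of_lt h]
        · simp [h]
        · simp [h.ne, h.not_gt, Nat.not_lt.mpr (Nat.succ_le_of_lt h)]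
      simp only [hσ, sum_add_distrib]
      rw [hx, error_step, ← add_assoc, ← ih, smul_add]
      conv_rhs => rw [← weight_split]
      abel
  intro k hk
  have shifted := invariant k
  rw [if_pos hk] at shifted
  refine ⟨shifted, fun he => ?_⟩
  rw [shifted]
  simpa using he
end
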